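/- arXiv:2604.19807 — 3 statements merged into one kernel-verified Lean document; each statement's English description precedes it below -/
import Mathlib

section
/- Assume there is a nonempty set I ⊆ Fin d and constants δ_min,i > 0 for each i ∈ I such that δᵢ σ e g − g ≥ δ_min,i for all σ, e, g, and assume Bᵢ ≥ 0 for each i ∈ I. Set Λ := min_{i ∈ I} ⌊Bᵢ / δ_min,i⌋. If a state (σ, c) satisfies cᵢ ≥ 0 for every i ∈ I and H(σ, c) < ⊤, then H(σ, c) ≤ Λ. -/
/-- Final signature after running an edge list. -/
def sigRun {Sg E : Type*} (α : Sg → E → Sg) : Sg → List E → Sg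
  | σ, [] => σ
  | σ, e :: r => sigRun α (α σ e) r

/-- Final cost vector after running an edge list: each step updates the cost in
dimension `i` by `δ i σ e`. -/
def costRun {Sg E : Type*} {d : ℕ} (α : Sg → E → Sg)
    (δ : Fin d → Sg → E → ℝ → ℝ) :
    Sg → (Fin d → ℝ) → List E → (Fin d → ℝ)
  | _, c, [] => c
  | σ, c, e :: r => costRun α δ (α σ e) (fun i => δ i σ e (c i)) r

/-- An edge list is a valid run from `σ` if each transition is valid from the
signature reached so far. -/
def validRun {Sg E : Type*} (α : Sg → E → Sg) (valid : Sg → E → Prop) :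
    Sg → List E → Prop
  | _, [] => True
  | σ, e :: r => valid σ e ∧ validRun α valid (α σ e) r

/-- An edge list `r` is a feasible extension of the state `(σ, c)` if it is a
valid run from `σ`, reaches a target signature, and respects the budget `B`
componentwise. -/
def feasibleExt {Sg E : Type*} {d : ℕ} (α : Sg → E → Sg)
    (δ : Fin d → Sg → E → ℝ → ℝ) (valid : Sg → E → Prop)
    (Tgt : Sg → Prop) (B : Fin d → ℝ)
    (σ : Sg) (c : Fin d → ℝ) (r : List E) : Prop :=
  validRun α valid σ r ∧ Tgt (sigRun α σ r) ∧ ∀ i, costRun α δ σ c r i ≤ B i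

/-- Completion potential: the infimum in `ℕ∞ = WithTop ℕ` of the lengths of
feasible extensions of `(σ, c)`, equal to `⊤` if none exists. -/
noncomputable def Hpot {Sg E : Type*} {d : ℕ} (α : Sg → E → Sg)
    (δ : Fin d → Sg → E → ℝ → ℝ) (valid : Sg → E → Prop)
    (Tgt : Sg → Prop) (B : Fin d → ℝ)
    (σ : Sg) (c : Fin d → ℝ) : ℕ∞ :=
  sInf ((fun r : List E => (r.length : ℕ∞)) ''
    {r | feasibleExt α δ valid Tgt B σ c r})

theorem costRun_lower {Sg E : Type*} {d : ℕ} (α : Sg → E → Sg)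
    (δ : Fin d → Sg → E → ℝ → ℝ) (i : Fin d) (m : ℝ)
    (h : ∀ (σ : Sg) (e : E) (g : ℝ), m ≤ δ i σ e g - g) (r : List E) :
    ∀ (σ : Sg) (c : Fin d → ℝ), c i + r.length * m ≤ costRun α δ σ c r i := by
  induction r with
  | nil => intro σ c; simp [costRun]
  | cons e r ih =>
    intro σ c
    have h1 := ih (α σ e) (fun i => δ i σ e (c i))
    have h2 := h σ e (c i)
    simp only [costRun, List.length_cons]
    push_cast
    linarith

/-- **Budget-driven potential bound.**
Suppose there is a nonempty set `I` of progressive dimensions with constants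
`δmin i > 0` for `i ∈ I` such that `δ i σ e g − g ≥ δmin i` for all `σ, e, g`,
and `B i ≥ 0` for each `i ∈ I`.  Set `Λ := min_{i ∈ I} ⌊B i / δmin i⌋`.  If a
state `(σ, c)` satisfies `c i ≥ 0` for every `i ∈ I` and its completion
potential is finite, then `H (σ, c) ≤ Λ`. -/
theorem budget_potential_bound {Sg E : Type*} (d : ℕ) (hd : 1 ≤ d)
    (α : Sg → E → Sg) (δ : Fin d → Sg → E → ℝ → ℝ)
    (valid : Sg → E → Prop) (Tgt : Sg → Prop) (B : Fin d → ℝ)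
    (I : Finset (Fin d)) (hI : I.Nonempty)
    (δmin : Fin d → ℝ) (hδminpos : ∀ i ∈ I, 0 < δmin i)
    (hprog : ∀ i ∈ I, ∀ (σ : Sg) (e : E) (g : ℝ), δmin i ≤ δ i σ e g - g)
    (hB : ∀ i ∈ I, 0 ≤ B i)
    (σ : Sg) (c : Fin d → ℝ) (hc : ∀ i ∈ I, 0 ≤ c i)
    (hfin : Hpot α δ valid Tgt B σ c < ⊤) :
    Hpot α δ valid Tgt B σ c ≤ (I.inf' hI (fun i => ⌊B i / δmin i⌋₊) : ℕ) := by
  have hne : ∃ r, feasibleExt α δ valid Tgt B σ c r := by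
    by_contra hcon
    push Not at hcon
    have : {r | feasibleExt α δ valid Tgt B σ c r} = ∅ := by
      ext r; simp [hcon r]
    simp [Hpot, this] at hfin
  obtain ⟨r, hr⟩ := hne
  have h1 : Hpot α δ valid Tgt B σ c ≤ (r.length : ℕ∞) :=
    sInf_le ⟨r, hr, rfl⟩
  refine h1.trans ?_
  have h2 : r.length ≤ I.inf' hI (fun i => ⌊B i / δmin i⌋₊) := by
    apply Finset.le_inf'
    intro i hi
    apply Nat.le_floor
    rw [le_div_iff₀ (hδminpos i hi)]
    have h3 := costRun_lower α δ i (δmin i) (hprog i hi) r σ c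
    have h4 := hr.2.2 i
    have h5 := hc i hi
    linarith
  exact_mod_cast h2
end

section
/- Assume each δᵢ is nondecreasing in its real argument and satisfies δᵢ σ e g ≥ g for all σ, e, g. If a state (σ, c) satisfies H(σ, c) = m with 1 ≤ m < ⊤, then there exists an edge e with valid σ e such that the successor state (α σ e, c'), where c'ᵢ = δᵢ σ e cᵢ for each i, satisfies c' ≤ B componentwise and H(α σ e, c') ≤ m − 1. -/
/-- Costs never decrease along a run. -/
theorem le_costRun_aux {Sg E : Type*} {d : ℕ} (α : Sg → E → Sg)
    (δ : Fin d → Sg → E → ℝ → ℝ)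
    (hge : ∀ (i : Fin d) (σ : Sg) (e : E) (g : ℝ), g ≤ δ i σ e g) (r : List E) :
    ∀ (σ : Sg) (c : Fin d → ℝ) (i : Fin d), c i ≤ costRun α δ σ c r i := by
  induction r with
  | nil => intro σ c i; exact le_rfl
  | cons e r ih =>
    intro σ c i
    exact (hge i σ e (c i)).trans (ih (α σ e) (fun i => δ i σ e (c i)) i)

/-- **One-step strict potential descent.**
Assume each `δ i σ e` is nondecreasing in its real argument and satisfies
`δ i σ e g ≥ g`.  If a state `(σ, c)` has completion potential `H (σ, c) = m`
with `1 ≤ m < ⊤`, then there is a valid edge `e` whose successor state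
`(α σ e, c')`, with `c' i = δ i σ e (c i)`, respects the budget componentwise
and satisfies `H (α σ e, c') ≤ m − 1`. -/
theorem potential_descent_step {Sg E : Type*} (d : ℕ) (hd : 1 ≤ d)
    (α : Sg → E → Sg) (δ : Fin d → Sg → E → ℝ → ℝ)
    (valid : Sg → E → Prop) (Tgt : Sg → Prop) (B : Fin d → ℝ)
    (hmono : ∀ (i : Fin d) (σ : Sg) (e : E) (g g' : ℝ),
      g ≤ g' → δ i σ e g ≤ δ i σ e g')
    (hge : ∀ (i : Fin d) (σ : Sg) (e : E) (g : ℝ), g ≤ δ i σ e g)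
    (σ : Sg) (c : Fin d → ℝ) (m : ℕ) (hm : 1 ≤ m)
    (hH : Hpot α δ valid Tgt B σ c = (m : ℕ∞)) :
    ∃ e : E, valid σ e ∧
      (∀ i, δ i σ e (c i) ≤ B i) ∧
      Hpot α δ valid Tgt B (α σ e) (fun i => δ i σ e (c i)) ≤ ((m - 1 : ℕ) : ℕ∞) := by
  have hne : ((fun r : List E => (r.length : ℕ∞)) ''
      {r | feasibleExt α δ valid Tgt B σ c r}).Nonempty := by
    by_contra h
    rw [Set.not_nonempty_iff_eq_empty] at h
    unfold Hpot at hH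
    rw [h, sInf_empty] at hH
    exact ENat.natCast_ne_top m hH.symm
  obtain ⟨r, hr, hlen⟩ := csInf_mem hne
  change _ = Hpot α δ valid Tgt B σ c at hlen
  rw [hH] at hlen
  dsimp only at hlen
  have hlen' : r.length = m := by exact_mod_cast hlen
  cases r with
  | nil => simp at hlen'; omega
  | cons e r =>
    obtain ⟨⟨hv, hvr⟩, ht, hc⟩ := hr
    refine ⟨e, hv, fun i => (le_costRun_aux α δ hge r _ _ i).trans (hc i), ?_⟩
    refine sInf_le ⟨r, ⟨hvr, ht, hc⟩, ?_⟩
    have : r.length = m - 1 := by simp at hlen'; omega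
    simp only [this]
end

section
/- Let F be a finite set of states in Σ × (Fin d → ℝ) with skyline L₁(F), let S be a set of cost vectors in Fin d → ℝ, and let δ_min : Fin d → ℝ with δ_min ≥ 0 componentwise. Suppose the stopping certificate holds: for every (σ, c) ∈ L₁(F) there exists s ∈ S with s ≤ c + δ_min componentwise. Then for every cost vector v such that some (σ, c) ∈ F satisfies c + δ_min ≤ v componentwise, there exists s* ∈ S with s* ≤ v componentwise. In particular, every feasible cost vector whose discovery must pass through a frontier state of F is dominated by an already-discovered solution. -/
/-- `p` strictly dominates `q`: same signature, componentwise smaller-or-equal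
cost, and distinct cost vectors. -/
def strictlyDominates {Sg : Type*} {d : ℕ}
    (p q : Sg × (Fin d → ℝ)) : Prop :=
  p.1 = q.1 ∧ (∀ i, p.2 i ≤ q.2 i) ∧ p.2 ≠ q.2

/-- **Soundness of the stopping certificate.**
Let `F` be a finite set of states with skyline `L₁(F)` (the elements of `F`
not strictly dominated within `F`), let `S` be a set of discovered solution
cost vectors, and let `δmin ≥ 0` componentwise.  Suppose the stopping
certificate holds: every skyline element `(σ, c)` admits some `s ∈ S` with
`s ≤ c + δmin` componentwise.  Then every cost vector `v` such that some
`(σ, c) ∈ F` satisfies `c + δmin ≤ v` componentwise is dominated by an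
already-discovered solution: there is `s* ∈ S` with `s* ≤ v` componentwise. -/
theorem certified_stopping {Sg : Type*} (d : ℕ) (hd : 1 ≤ d)
    (F : Finset (Sg × (Fin d → ℝ)))
    (S : Set (Fin d → ℝ))
    (δmin : Fin d → ℝ) (hδmin : ∀ i, 0 ≤ δmin i)
    (hcert : ∀ p ∈ F, (∀ q ∈ F, ¬ strictlyDominates q p) →
      ∃ s ∈ S, ∀ i, s i ≤ p.2 i + δmin i) :
    ∀ v : Fin d → ℝ, (∃ p ∈ F, ∀ i, p.2 i + δmin i ≤ v i) →
      ∃ s ∈ S, ∀ i, s i ≤ v i := by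
  classical
  rintro v ⟨p, hp, hpv⟩
  obtain ⟨m, hm, hmin⟩ := Finset.exists_min_image
    (F.filter (fun q => ∀ i, q.2 i + δmin i ≤ v i)) (fun q => ∑ i, q.2 i)
    ⟨p, Finset.mem_filter.mpr ⟨hp, hpv⟩⟩
  obtain ⟨hmF, hmv⟩ := Finset.mem_filter.mp hm
  obtain ⟨s, hs, hsm⟩ := hcert m hmF (by
    rintro q hq ⟨_, hle, hne⟩
    obtain ⟨j, hj⟩ := Function.ne_iff.mp hne
    have h1 : ∑ i, q.2 i < ∑ i, m.2 i :=
      Finset.sum_lt_sum (fun i _ => hle i)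
        ⟨j, Finset.mem_univ j, lt_of_le_of_ne (hle j) hj⟩
    have h2 := hmin q (Finset.mem_filter.mpr
      ⟨hq, fun i => by linarith [hle i, hmv i]⟩)
    exact absurd h1 (not_lt.mpr h2))
  exact ⟨s, hs, fun i => (hsm i).trans (hmv i)⟩
end
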